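/- Let (N,M₀) be a safe Petri net with unfolding U and B⊆2^P reachability-closed. If C is a finite configuration of U and e∈crest(C) is unchallenged, then C is doomed if and only if C∖{e} is doomed (equivalently, C is free iff C∖{e} is free). -/

import Mathlib

/-- A net `N = (P,T,F)`: the flow relation is split into its
place-to-transition part `pt` and transition-to-place part `tp`. -/
structure Net (P T : Type) where
  pt : P → T → Prop
  tp : T → P → Prop

namespace Net

variable {P T : Type} (N : Net P T)

/-- Preset of a transition: `•t`. -/
def preT (t : T) : Set P := {p | N.pt p t}
/-- Postset of a transition: `t•`. -/
def postT (t : T) : Set P := {p | N.tp t p}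
/-- Preset of a place: `•p`. -/
def preP (p : P) : Set T := {t | N.tp t p}
/-- Postset of a place: `p•`. -/
def postP (p : P) : Set T := {t | N.pt p t}

/-- Transition `t` is enabled at marking `M` iff `•t ⊆ M`. -/
def enabled (M : Set P) (t : T) : Prop := N.preT t ⊆ M
/-- Firing `t` at `M` yields `(M \ •t) ∪ t•`. -/
def fire (M : Set P) (t : T) : Set P := (M \ N.preT t) ∪ N.postT t
/-- One firing step between markings. -/
def stepRel (M M' : Set P) : Prop := ∃ t : T, N.enabled M t ∧ M' = N.fire M t
/-- Reachability between markings (finite firing sequences). -/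
def reach (M M' : Set P) : Prop := Relation.ReflTransGen N.stepRel M M'

/-- `(N, M₀)` is safe. -/
def safe (M₀ : Set P) : Prop :=
  ∀ M : Set P, N.reach M₀ M → ∀ t : T, N.enabled M t → M ∩ N.postT t ⊆ N.preT t

/-- `FiringSeq M l M'`: the sequence `l` of transitions can fire from `M`, ending in `M'`. -/
inductive FiringSeq : Set P → List T → Set P → Prop
  | nil (M : Set P) : FiringSeq M [] M
  | cons {M : Set P} (t : T) {l : List T} {M' : Set P} :
      N.enabled M t → FiringSeq (N.fire M t) l M' → FiringSeq M (t :: l) M'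

/-- The underlying edge relation of the flow, on nodes `P ⊕ T`. -/
def edge : (P ⊕ T) → (P ⊕ T) → Prop
  | Sum.inl p, Sum.inr t => N.pt p t
  | Sum.inr t, Sum.inl p => N.tp t p
  | _, _ => False

/-- Causality: `x < y` via a nonempty directed path. -/
def ltN (x y : P ⊕ T) : Prop := Relation.TransGen N.edge x y
/-- `x ≤ y` iff `x < y` or `x = y`. -/
def leN (x y : P ⊕ T) : Prop := N.ltN x y ∨ x = y

/-- Direct conflict of transitions: `•u ∩ •v ≠ ∅`. -/
def dirConflict (u v : T) : Prop := (N.preT u ∩ N.preT v).Nonempty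
/-- Conflict of nodes `x # y`. -/
def conflict (x y : P ⊕ T) : Prop :=
  ∃ u v : T, u ≠ v ∧ N.leN (Sum.inr u) x ∧ N.leN (Sum.inr v) y ∧ N.dirConflict u v
/-- Concurrency of nodes. -/
def concurrent (x y : P ⊕ T) : Prop :=
  ¬ N.leN x y ∧ ¬ N.leN y x ∧ ¬ N.conflict x y
/-- A co-set: a set of pairwise concurrent places (conditions). -/
def coset (S : Set P) : Prop :=
  ∀ b ∈ S, ∀ b' ∈ S, b ≠ b' → N.concurrent (Sum.inl b) (Sum.inl b')

end Net

/-- An occurrence net `O = (B, E, F, c₀)`: conditions `B`, events `E`. -/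
structure OccNet (B E : Type) extends Net B E where
  c₀ : Set B
  lt_irrefl : ∀ x : B ⊕ E, ¬ toNet.ltN x x
  pre_subsingleton : ∀ b : B, (toNet.preP b).Subsingleton
  mem_c₀_iff : ∀ b : B, b ∈ c₀ ↔ toNet.preP b = ∅
  no_self_conflict : ∀ e : E, ¬ toNet.conflict (Sum.inr e) (Sum.inr e)
  finite_past : ∀ e : E, {x : B ⊕ E | toNet.leN x (Sum.inr e)}.Finite

namespace OccNet

variable {B E : Type} (O : OccNet B E)

/-- A configuration: a causally closed, conflict-free set of events. -/
def config (C : Set E) : Prop :=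
  (∀ e ∈ C, ∀ e' : E, O.toNet.ltN (Sum.inr e') (Sum.inr e) → e' ∈ C) ∧
  (∀ e ∈ C, ∀ e' ∈ C, ¬ O.toNet.conflict (Sum.inr e) (Sum.inr e'))

/-- A run: a `⊆`-maximal configuration. -/
def run (ω : Set E) : Prop :=
  O.config ω ∧ ∀ C : Set E, O.config C → ω ⊆ C → C = ω

/-- `cut C = (c₀ ∪ C•) \ •C`. -/
def cut (C : Set E) : Set B :=
  (O.c₀ ∪ {b | ∃ e ∈ C, O.toNet.tp e b}) \ {b | ∃ e ∈ C, O.toNet.pt b e}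

/-- Event `e` is enabled by configuration `C`. -/
def enabledBy (C : Set E) (e : E) : Prop := e ∉ C ∧ O.config (C ∪ {e})

/-- `crest C`: the `<`-maximal events of `C`. -/
def crest (C : Set E) : Set E :=
  {e | e ∈ C ∧ ¬ ∃ e' ∈ C, O.toNet.ltN (Sum.inr e) (Sum.inr e')}

/-- The stump `⌊e⌋ = {e' : e' < e}` of an event. -/
def stump (e : E) : Set E := {e' | O.toNet.ltN (Sum.inr e') (Sum.inr e)}

/-- `spoiler e e'`: `e'` is a spoiler of `e`, i.e. `•e' ∩ •e ≠ ∅`. -/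
def spoiler (e e' : E) : Prop := (O.toNet.preT e' ∩ O.toNet.preT e).Nonempty

/-- An event is unchallenged iff no other event shares a precondition with it. -/
def unchallenged (e : E) : Prop :=
  ¬ ∃ e' : E, e' ≠ e ∧ (O.toNet.preT e' ∩ O.toNet.preT e).Nonempty

/-- A configuration is shaved iff its crest contains no unchallenged event. -/
def shaved (C : Set E) : Prop := ∀ e ∈ O.crest C, ¬ O.unchallenged e

/-- Strict `C`-conflict `e #^C e'`: `e ≠ e'`, `•e ∩ •e' ≠ ∅`, and `⌊e'⌋ ⊆ C`. -/
def strictConflict (C : Set E) (e e' : E) : Prop :=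
  e ≠ e' ∧ (O.toNet.preT e ∩ O.toNet.preT e').Nonempty ∧ O.stump e' ⊆ C

/-- Decisional height `δ(C)`: the number of events of `C` in strict `C`-conflict
with some event. -/
noncomputable def dHeight (C : Set E) : ℕ :=
  {e | e ∈ C ∧ ∃ e' : E, O.strictConflict C e e'}.ncard

end OccNet

/-- The unfolding `U = U(N, M₀)` of a Petri net `(N, M₀)`: an occurrence net with
conditions `B` and events `E`, together with the folding map (`fB` on conditions,
`fE` on events), satisfying the defining properties of the inductive construction:
the initial cut corresponds bijectively to `M₀`; the preset of an event `e` is a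
co-set folded bijectively onto `•f(e)` and its postset is folded bijectively onto
`f(e)•`; events are uniquely determined by (preset, label) and exist for every
co-set folding onto some `•t`; conditions are uniquely determined by
(producing event, label). -/
structure Unfolding (P T : Type) (N : Net P T) (M₀ : Set P) (B E : Type) where
  occ : OccNet B E
  fB : B → P
  fE : E → T
  init_bij : Set.BijOn fB occ.c₀ M₀
  pre_coset : ∀ e : E, occ.toNet.coset (occ.toNet.preT e)
  pre_bij : ∀ e : E, Set.BijOn fB (occ.toNet.preT e) (N.preT (fE e))
  post_bij : ∀ e : E, Set.BijOn fB (occ.toNet.postT e) (N.postT (fE e))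
  event_unique : ∀ e e' : E,
    occ.toNet.preT e = occ.toNet.preT e' → fE e = fE e' → e = e'
  event_exists : ∀ (S : Set B) (t : T), occ.toNet.coset S → Set.BijOn fB S (N.preT t) →
    ∃ e : E, occ.toNet.preT e = S ∧ fE e = t
  cond_unique : ∀ b b' : B,
    occ.toNet.preP b = occ.toNet.preP b' → fB b = fB b' → b = b'

/-- `Bad` is reachability-closed: `M ∈ Bad` and `M → M'` imply `M' ∈ Bad`. -/
def ReachClosed {P T : Type} (N : Net P T) (Bad : Set (Set P)) : Prop :=
  ∀ M ∈ Bad, ∀ M' : Set P, N.reach M M' → M' ∈ Bad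

namespace Unfolding

variable {P T B E : Type} {N : Net P T} {M₀ : Set P} (U : Unfolding P T N M₀ B E)

/-- `Mark C = f(cut C)`. -/
def Mark (C : Set E) : Set P := U.fB '' U.occ.cut C

/-- A finite configuration is doomed iff every run extending it contains a finite
configuration (extending it) whose marking is bad. -/
def doomed (Bad : Set (Set P)) (C : Set E) : Prop :=
  ∀ ω : Set E, U.occ.run ω → C ⊆ ω →
    ∃ C' : Set E, C'.Finite ∧ U.occ.config C' ∧ C ⊆ C' ∧ C' ⊆ ω ∧ U.Mark C' ∈ Bad

/-- A configuration is free iff it is not doomed. -/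
def free (Bad : Set (Set P)) (C : Set E) : Prop := ¬ U.doomed Bad C

/-- A finite configuration is minimally doomed iff it is doomed and no proper
sub-configuration of it is doomed. -/
def minDoomed (Bad : Set (Set P)) (C : Set E) : Prop :=
  C.Finite ∧ U.occ.config C ∧ U.doomed Bad C ∧
  ∀ C' : Set E, C' ⊂ C → U.occ.config C' → ¬ U.doomed Bad C'

/-- A (finite) prefix of the unfolding: a finite, causally closed set of events. -/
def isPrefix (E' : Set E) : Prop :=
  E'.Finite ∧ ∀ e ∈ E', ∀ e' : E, U.occ.toNet.ltN (Sum.inr e') (Sum.inr e) → e' ∈ E'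

/-- A complete prefix `Π₀` of the unfolding. -/
def isCompletePrefix (E' : Set E) : Prop :=
  U.isPrefix E' ∧
  ∀ M : Set P, N.reach M₀ M →
    ∃ C : Set E, U.occ.config C ∧ C ⊆ E' ∧ U.Mark C = M ∧
      ∀ t : T, N.enabled M t → ∃ e ∈ E', U.fE e = t ∧ U.occ.enabledBy C e

/-- `isPi1 E₀ E₁`: `E₀` is a complete prefix `Π₀` and `E₁` is the prefix `Π₁`
obtained by appending, after every `⊆`-maximal configuration `Cm` of `Π₀`, a
complete prefix of the unfolding of `(N, Mark Cm)`. -/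
def isPi1 (E₀ E₁ : Set E) : Prop :=
  U.isCompletePrefix E₀ ∧ U.isPrefix E₁ ∧ E₀ ⊆ E₁ ∧
  ∀ Cm : Set E, U.occ.config Cm → Cm ⊆ E₀ →
    (∀ C' : Set E, U.occ.config C' → C' ⊆ E₀ → Cm ⊆ C' → C' = Cm) →
    ∀ M : Set P, N.reach (U.Mark Cm) M →
      ∃ C : Set E, U.occ.config C ∧ Cm ⊆ C ∧ C ⊆ E₁ ∧ U.Mark C = M ∧
        ∀ t : T, N.enabled M t → ∃ e ∈ E₁, U.fE e = t ∧ U.occ.enabledBy C e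

end Unfolding

namespace OccNet

variable {B E : Type} (O : OccNet B E)

theorem ltN_of_pre {e' e : E} {b : B} (h' : O.toNet.tp e' b) (h : O.toNet.pt b e) :
    O.toNet.ltN (Sum.inr e') (Sum.inr e) :=
  .tail (b := Sum.inl b) (.single h') h

theorem config.mem_of_leN {O : OccNet B E} {C : Set E} (hC : O.config C) {e e' : E} (he : e ∈ C)
    (h : O.toNet.leN (Sum.inr e') (Sum.inr e)) : e' ∈ C := by
  rcases h with h | h
  · exact hC.1 e he e' h
  · cases h
    exact he

theorem config.diff_crest {O : OccNet B E} {C : Set E} (hC : O.config C) {e : E}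
    (he : e ∈ O.crest C) : O.config (C \ {e}) := by
  refine ⟨fun a ha a' h => ⟨hC.1 a ha.1 a' h, ?_⟩, fun a ha a' ha' => hC.2 a ha.1 a' ha'.1⟩
  rintro rfl
  exact he.2 ⟨a, ha.1, h⟩

theorem config.union_of_subset {O : OccNet B E} {C D ω : Set E} (hω : O.config ω)
    (hC : O.config C) (hD : O.config D) (hCω : C ⊆ ω) (hDω : D ⊆ ω) : O.config (C ∪ D) := by
  refine ⟨?_, fun a ha a' ha' =>
    hω.2 a (Set.union_subset hCω hDω ha) a' (Set.union_subset hCω hDω ha')⟩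
  rintro a (ha | ha) a' h
  · exact .inl (hC.1 a ha a' h)
  · exact .inr (hD.1 a ha a' h)

theorem crest_nonempty {C : Set E} (hfin : C.Finite) (hne : C.Nonempty) :
    (O.crest C).Nonempty := by
  let r : E → E → Prop := fun a b => O.toNet.ltN (Sum.inr b) (Sum.inr a)
  have : IsStrictOrder E r :=
    { irrefl := fun a => O.lt_irrefl _
      trans := fun a b c hab hbc => Relation.TransGen.trans hbc hab }
  obtain ⟨x, hx⟩ := hne
  obtain ⟨m, -, hm⟩ := (hfin.wellFoundedOn (r := r)).has_min Set.univ ⟨⟨x, hx⟩, trivial⟩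
  exact ⟨m, m.2, fun ⟨e', he', h⟩ => hm ⟨e', he'⟩ trivial h⟩

theorem preT_subset_cut {C : Set E} {e : E} (h : O.enabledBy C e) : O.toNet.preT e ⊆ O.cut C := by
  intro b hb
  refine ⟨?_, ?_⟩
  · by_cases h0 : b ∈ O.c₀
    · exact .inl h0
    · obtain ⟨e', he'⟩ := Set.nonempty_iff_ne_empty.2 (mt (O.mem_c₀_iff b).2 h0)
      have hlt := O.ltN_of_pre he' hb
      rcases h.2.1 e (.inr rfl) e' hlt with hC | rfl
      · exact .inr ⟨e', hC, he'⟩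
      · exact (O.lt_irrefl _ hlt).elim
  · rintro ⟨e', he', hb'⟩
    refine h.2.2 e' (.inl he') e (.inr rfl) ⟨e', e, ?_, .inr rfl, .inr rfl, b, hb', hb⟩
    rintro rfl
    exact h.1 he'

theorem cut_union_singleton {C : Set E} (hC : O.config C) {e : E} (h : O.enabledBy C e) :
    O.cut (C ∪ {e}) = (O.cut C \ O.toNet.preT e) ∪ O.toNet.postT e := by
  ext b
  constructor
  · rintro ⟨hb, hn⟩
    have hn1 : ¬ ∃ a ∈ C, O.toNet.pt b a := fun ⟨a, ha, hab⟩ => hn ⟨a, .inl ha, hab⟩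
    have hn2 : ¬ O.toNet.pt b e := fun hbe => hn ⟨e, .inr rfl, hbe⟩
    rcases hb with hb | ⟨a, ha | rfl, hab⟩
    · exact .inl ⟨⟨.inl hb, hn1⟩, hn2⟩
    · exact .inl ⟨⟨.inr ⟨a, ha, hab⟩, hn1⟩, hn2⟩
    · exact .inr hab
  · rintro (⟨⟨hb, hn⟩, hne⟩ | hb)
    · refine ⟨hb.imp id fun ⟨a, ha, hab⟩ => ⟨a, .inl ha, hab⟩, ?_⟩
      rintro ⟨a, ha | rfl, hab⟩
      · exact hn ⟨a, ha, hab⟩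
      · exact hne hab
    · refine ⟨.inr ⟨e, .inr rfl, hb⟩, ?_⟩
      rintro ⟨a, ha, hab⟩
      have hlt := O.ltN_of_pre hb hab
      rcases ha with ha | rfl
      · exact h.1 (hC.1 a ha e hlt)
      · exact O.lt_irrefl _ hlt

/-- A run containing all proper causes of an unchallenged event contains that event. -/
theorem run.mem_of_unchallenged {O : OccNet B E} {ω : Set E} (hω : O.run ω) {e : E}
    (hu : O.unchallenged e) (hs : O.stump e ⊆ ω) : e ∈ ω := by
  have key : ∀ a ∈ ω, ∀ u v : E, u ≠ v → O.toNet.leN (Sum.inr u) (Sum.inr a) →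
      O.toNet.leN (Sum.inr v) (Sum.inr e) → ¬ O.toNet.dirConflict u v := by
    intro a ha u v huv hua hve hd
    have huω := hω.1.mem_of_leN ha hua
    rcases hve with hve | hve
    · exact hω.1.2 u huω v (hs hve) ⟨u, v, huv, .inr rfl, .inr rfl, hd⟩
    · cases hve
      exact hu ⟨u, huv, hd⟩
  have hconf : O.config (ω ∪ {e}) := by
    refine ⟨?_, ?_⟩
    · rintro a (ha | rfl) a' h
      · exact .inl (hω.1.1 a ha a' h)
      · exact .inl (hs h)
    · rintro a (ha | rfl) a' (ha' | rfl)
      · exact hω.1.2 a ha a' ha'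
      · rintro ⟨u, v, huv, hu', hv', hd⟩
        exact key a ha u v huv hu' hv' hd
      · rintro ⟨u, v, huv, hu', hv', hd⟩
        exact key a' ha' v u huv.symm hv' hu' (by rwa [Net.dirConflict, Set.inter_comm])
      · exact O.no_self_conflict _
  have hmem : e ∈ ω ∪ {e} := .inr rfl
  rwa [hω.2 _ hconf Set.subset_union_left] at hmem

end OccNet

namespace Unfolding

variable {P T B E : Type} {N : Net P T} {M₀ : Set P} (U : Unfolding P T N M₀ B E)

theorem enabled_Mark {C : Set E} {e : E} (h : U.occ.enabledBy C e) :
    N.enabled (U.Mark C) (U.fE e) := by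
  unfold Net.enabled
  rw [← (U.pre_bij e).image_eq]
  exact Set.image_mono (U.occ.preT_subset_cut h)

theorem Mark_union_singleton {C : Set E} (hC : U.occ.config C) {e : E}
    (h : U.occ.enabledBy C e) (hinj : Set.InjOn U.fB (U.occ.cut C)) :
    U.Mark (C ∪ {e}) = N.fire (U.Mark C) (U.fE e) := by
  unfold Mark Net.fire
  rw [U.occ.cut_union_singleton hC h, Set.image_union, (U.post_bij e).image_eq,
    hinj.image_sdiff_subset (U.occ.preT_subset_cut h), (U.pre_bij e).image_eq]

theorem injOn_cut_union_singleton (hsafe : N.safe M₀) {C : Set E} (hC : U.occ.config C) {e : E}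
    (h : U.occ.enabledBy C e) (hinj : Set.InjOn U.fB (U.occ.cut C))
    (hreach : N.reach M₀ (U.Mark C)) : Set.InjOn U.fB (U.occ.cut (C ∪ {e})) := by
  have hne : ∀ b ∈ U.occ.cut C \ U.occ.toNet.preT e, ∀ b' ∈ U.occ.toNet.postT e,
      U.fB b ≠ U.fB b' := by
    intro b hb b' hb' heq
    have hp : U.fB b ∈ N.preT (U.fE e) :=
      hsafe _ hreach _ (U.enabled_Mark h)
        ⟨Set.mem_image_of_mem _ hb.1, heq ▸ (U.post_bij e).mapsTo hb'⟩
    obtain ⟨c, hc, hcb⟩ := (U.pre_bij e).surjOn hp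
    exact hb.2 (hinj (U.occ.preT_subset_cut h hc) hb.1 hcb ▸ hc)
  rw [U.occ.cut_union_singleton hC h]
  rintro b (hb | hb) b' (hb' | hb') heq
  · exact hinj hb.1 hb'.1 heq
  · exact (hne b hb b' hb' heq).elim
  · exact (hne b' hb' b hb heq.symm).elim
  · exact (U.post_bij e).injOn hb hb' heq

/-- In the unfolding of a safe net, every finite configuration has a reachable marking, and its
cut carries each place at most once. -/
theorem reach_Mark_and_injOn_cut (hsafe : N.safe M₀) {C : Set E} (hfin : C.Finite)
    (hC : U.occ.config C) : N.reach M₀ (U.Mark C) ∧ Set.InjOn U.fB (U.occ.cut C) := by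
  induction hn : C.ncard generalizing C with
  | zero =>
    obtain rfl := (Set.ncard_eq_zero hfin).1 hn
    have hcut : U.occ.cut ∅ = U.occ.c₀ := by simp [OccNet.cut]
    rw [Mark, hcut, U.init_bij.image_eq]
    exact ⟨.refl, U.init_bij.injOn⟩
  | succ n ih =>
    obtain ⟨e, he⟩ := U.occ.crest_nonempty hfin (Set.nonempty_of_ncard_ne_zero (by omega))
    have hD := hC.diff_crest he
    have heq : C \ {e} ∪ {e} = C := Set.sdiff_union_of_subset (Set.singleton_subset_iff.2 he.1)
    have hen : U.occ.enabledBy (C \ {e}) e := ⟨fun h => h.2 rfl, heq.symm ▸ hC⟩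
    obtain ⟨hr, hi⟩ := ih hfin.sdiff hD (by rw [Set.ncard_sdiff_singleton_of_mem he.1]; omega)
    rw [← heq]
    exact ⟨hr.tail ⟨_, U.enabled_Mark hen, U.Mark_union_singleton hD hen hi⟩,
      U.injOn_cut_union_singleton hsafe hD hen hi hr⟩

end Unfolding

/-- for a finite configuration `C` of the unfolding of a safe
Petri net and an unchallenged event `e ∈ crest C`, `C` is doomed iff `C \ {e}`
is doomed (equivalently, `C` is free iff `C \ {e}` is free). -/
theorem doomed_iff_shave_unchallenged
    {P T B E : Type} [Finite P] [Finite T]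
    (N : Net P T) (M₀ : Set P) (hsafe : N.safe M₀)
    (U : Unfolding P T N M₀ B E)
    (Bad : Set (Set P)) (hBad : ReachClosed N Bad)
    (C : Set E) (hfin : C.Finite) (hC : U.occ.config C)
    (e : E) (he : e ∈ U.occ.crest C) (hu : U.occ.unchallenged e) :
    (U.doomed Bad C ↔ U.doomed Bad (C \ {e})) ∧
    (U.free Bad C ↔ U.free Bad (C \ {e})) := by
  have hsub : C \ {e} ⊆ C := Set.sdiff_subset
  have hiff : U.doomed Bad C ↔ U.doomed Bad (C \ {e}) := by
    constructor
    · intro hd ω hω hDω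
      have heω : e ∈ ω := hω.mem_of_unchallenged hu fun a ha => hDω ⟨hC.1 e he.1 a ha, by
        rintro rfl
        exact U.occ.lt_irrefl _ ha⟩
      have hCω : C ⊆ ω := fun a ha => by
        by_cases hae : a = e
        · exact hae ▸ heω
        · exact hDω ⟨ha, hae⟩
      obtain ⟨C', hf, hc, hCC', hC'ω, hb⟩ := hd ω hω hCω
      exact ⟨C', hf, hc, hsub.trans hCC', hC'ω, hb⟩
    · intro hd ω hω hCω
      obtain ⟨C', hf, hc, hDC', hC'ω, hb⟩ := hd ω hω (hsub.trans hCω)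
      have heq : C' ∪ {e} = C' ∪ C := by
        rw [← Set.sdiff_union_of_subset (Set.singleton_subset_iff.2 he.1), ← Set.union_assoc,
          Set.union_eq_self_of_subset_right hDC']
      have hconf : U.occ.config (C' ∪ {e}) := heq ▸ hω.1.union_of_subset hc hC hC'ω hCω
      refine ⟨C' ∪ {e}, hf.union (Set.finite_singleton e), hconf, ?_,
        Set.union_subset hC'ω (Set.singleton_subset_iff.2 (hCω he.1)), ?_⟩
      · exact heq ▸ Set.subset_union_right
      · by_cases heC' : e ∈ C'
        · rwa [Set.union_eq_self_of_subset_right (Set.singleton_subset_iff.2 heC')]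
        · have hinj := (U.reach_Mark_and_injOn_cut hsafe hf hc).2
          exact hBad _ hb _ (.single ⟨U.fE e, U.enabled_Mark ⟨heC', hconf⟩,
            U.Mark_union_singleton hc ⟨heC', hconf⟩ hinj⟩)
  exact ⟨hiff, not_congr hiff⟩
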